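/- arXiv:2509.08530 — 3 statements merged into one kernel-verified Lean document; each statement's English description precedes it below -/
import Mathlib

section
/- Let V be a type, let x_0, x_1, …, x_m be pairwise distinct elements of V, and let θ_0, …, θ_{m−1} ∈ {0,1} with θ_0 + … + θ_{m−1} ≥ 2 (at least two cannot-links among the path constraints). Then there exist labelings ℓ₁, ℓ₂ : V → ℕ, each of which satisfies the constraint (x_i, x_{i+1}, θ_i) for every i < m, such that ℓ₁ x_0 = ℓ₁ x_m and ℓ₂ x_0 ≠ ℓ₂ x_m. (Corollary 7: a path containing two or more cannot-link constraints cannot determine the relation between its endpoints.) -/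
/-- A pairwise constraint is a triple `(x, y, θ)`; `θ = false` is a must-link,
`θ = true` is a cannot-link. A labeling `ℓ` satisfies it accordingly. -/
def Satisfies {V : Type*} (ℓ : V → ℕ) (c : V × V × Bool) : Prop :=
  if c.2.2 = true then ℓ c.1 ≠ ℓ c.2.1 else ℓ c.1 = ℓ c.2.1

/-- `ℓ` is consistent with the constraint graph `C`. -/
def Consistent {V : Type*} (ℓ : V → ℕ) (C : Finset (V × V × Bool)) : Prop :=
  ∀ c ∈ C, Satisfies ℓ c

/-- `p 0 = x, …, p m = y` is a walk from `x` to `y` in `C`, where the `i`-th step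
traverses a constraint of type `θ i` present in `C` in either direction. -/
def IsWalk {V : Type*} (C : Finset (V × V × Bool)) (x y : V) (m : ℕ)
    (p : ℕ → V) (θ : ℕ → Bool) : Prop :=
  p 0 = x ∧ p m = y ∧ ∀ i < m, (p i, p (i + 1), θ i) ∈ C ∨ (p (i + 1), p i, θ i) ∈ C

/-- The weight of a walk: the number of cannot-link constraints traversed. -/
def walkWeight (m : ℕ) (θ : ℕ → Bool) : ℕ :=
  ∑ i ∈ Finset.range m, if θ i then 1 else 0

theorem walkWeight_succ (m : ℕ) (θ : ℕ → Bool) :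
    walkWeight (m + 1) θ = walkWeight m θ + if θ m then 1 else 0 :=
  Finset.sum_range_succ _ _

theorem walkWeight_mono (θ : ℕ → Bool) : Monotone fun m => walkWeight m θ :=
  monotone_nat_of_le_succ fun m => by simp [walkWeight_succ]

/-- A labeling of the positions of an injective path extends to its ambient type. -/
theorem exists_labeling_of_injOn {V : Type*} {m : ℕ} {p : ℕ → V}
    (hp : Set.InjOn p (Set.Iic m)) (g : ℕ → ℕ) :
    ∃ ℓ : V → ℕ, ∀ i ≤ m, ℓ (p i) = g i :=
  ⟨g ∘ Function.invFunOn p (Set.Iic m), fun _ hi =>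
    congrArg g (hp.leftInvOn_invFunOn hi)⟩

/-- Corollary 7: a path of pairwise distinct nodes containing at least two
cannot-link constraints cannot determine the relation between its endpoints. -/
theorem two_cannotLinks_undetermined {V : Type*} (m : ℕ) (p : ℕ → V) (θ : ℕ → Bool)
    (hdistinct : ∀ i ≤ m, ∀ j ≤ m, i ≠ j → p i ≠ p j)
    (hw : 2 ≤ walkWeight m θ) :
    (∃ ℓ₁ : V → ℕ, (∀ i < m, Satisfies ℓ₁ (p i, p (i + 1), θ i)) ∧ ℓ₁ (p 0) = ℓ₁ (p m)) ∧
    (∃ ℓ₂ : V → ℕ, (∀ i < m, Satisfies ℓ₂ (p i, p (i + 1), θ i)) ∧ ℓ₂ (p 0) ≠ ℓ₂ (p m)) := by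
  have hp : Set.InjOn p (Set.Iic m) := fun i hi j hj hij =>
    by_contra fun hne => hdistinct i hi j hj hne hij
  have h0 : walkWeight 0 θ = 0 := rfl
  constructor
  · obtain ⟨ℓ, hℓ⟩ := exists_labeling_of_injOn hp
      fun i => if walkWeight i θ = walkWeight m θ then 0 else walkWeight i θ
    refine ⟨ℓ, fun i hi => ?_, ?_⟩
    · have hs := walkWeight_succ i θ
      have hle : walkWeight (i + 1) θ ≤ walkWeight m θ := walkWeight_mono θ hi
      simp only [Satisfies, hℓ i hi.le, hℓ (i + 1) hi]
      cases hθ : θ i <;> simp only [hθ] at hs ⊢ <;> grind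
    · rw [hℓ 0 m.zero_le, hℓ m le_rfl]
      simp [h0]
  · obtain ⟨ℓ, hℓ⟩ := exists_labeling_of_injOn hp fun i => walkWeight i θ
    refine ⟨ℓ, fun i hi => ?_, ?_⟩
    · simp only [Satisfies, hℓ i hi.le, hℓ (i + 1) hi, walkWeight_succ]
      cases θ i <;> simp
    · rw [hℓ 0 m.zero_le, hℓ m le_rfl, h0]
      omega
end

section
/- Let V be a finite type, let C be a finite set of pairwise constraints on V that admits at least one consistent labeling ℓ : V → ℕ, let x, y ∈ V with x ≠ y, suppose there exists at least one walk from x to y in C, and let w be the minimum weight over all walks from x to y in C. Then: (i) if w = 0, every labeling ℓ : V → ℕ consistent with C satisfies ℓ x = ℓ y (must-link is deduced); (ii) if w = 1, every labeling ℓ : V → ℕ consistent with C satisfies ℓ x ≠ ℓ y (cannot-link is deduced); (iii) if w ≥ 2, there exist labelings ℓ₁, ℓ₂ : V → ℕ, both consistent with C, such that ℓ₁ x = ℓ₁ y and ℓ₂ x ≠ ℓ₂ y (no constraint can be deduced). (Theorem 1: pairwise constraint deduction via the minimum-weight path.) -/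
/-- The vertices `a` and `b` are joined by a chain of must-link constraints. -/
def mustLinkSetoid {V : Type*} (C : Finset (V × V × Bool)) : Setoid V :=
  Relation.EqvGen.setoid fun a b => (a, b, false) ∈ C

/-- There is a walk of weight `k` from `x` to `y` in `C`. -/
def HasWalk {V : Type*} (C : Finset (V × V × Bool)) (x y : V) (k : ℕ) : Prop :=
  ∃ m p θ, IsWalk C x y m p θ ∧ walkWeight m θ = k

theorem HasWalk.refl {V : Type*} (C : Finset (V × V × Bool)) (x : V) : HasWalk C x x 0 :=
  ⟨0, fun _ => x, fun _ => false, ⟨rfl, rfl, by simp⟩, rfl⟩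

theorem HasWalk.cons {V : Type*} {C : Finset (V × V × Bool)} {x y z : V} {k : ℕ} {t : Bool}
    (ht : (x, y, t) ∈ C ∨ (y, x, t) ∈ C) (h : HasWalk C y z k) :
    HasWalk C x z (k + if t then 1 else 0) := by
  obtain ⟨m, p, θ, ⟨h0, hm, hs⟩, hk⟩ := h
  refine ⟨m + 1, fun i => Nat.casesOn i x p, fun i => Nat.casesOn i t θ, ⟨rfl, hm, ?_⟩, ?_⟩
  · rintro (_ | i) hi
    · simpa [h0] using ht
    · exact hs i (by omega)
  · rw [← hk]
    exact Finset.sum_range_succ' _ _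

theorem hasWalk_iff_of_mustLink {V : Type*} {C : Finset (V × V × Bool)} {a b : V}
    (h : (mustLinkSetoid C).r a b) (z : V) (k : ℕ) : HasWalk C a z k ↔ HasWalk C b z k := by
  induction h with
  | rel a b hab => exact ⟨fun h => h.cons (.inr hab), fun h => h.cons (.inl hab)⟩
  | refl => rfl
  | symm _ _ _ ih => exact ih.symm
  | trans _ _ _ _ _ ih₁ ih₂ => exact ih₁.trans ih₂

theorem Consistent.eq_of_mustLink {V : Type*} {C : Finset (V × V × Bool)} {ℓ : V → ℕ}
    (hℓ : Consistent ℓ C) {a b : V} (h : (mustLinkSetoid C).r a b) : ℓ a = ℓ b := by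
  induction h with
  | rel a b hab => simpa [Satisfies] using hℓ _ hab
  | refl => rfl
  | symm _ _ _ ih => exact ih.symm
  | trans _ _ _ _ _ ih₁ ih₂ => exact ih₁.trans ih₂

theorem Consistent.of_walkWeight {V : Type*} {C : Finset (V × V × Bool)} {ℓ : V → ℕ}
    (hℓ : Consistent ℓ C) {p : ℕ → V} {θ : ℕ → Bool} (m : ℕ)
    (hs : ∀ i < m, (p i, p (i + 1), θ i) ∈ C ∨ (p (i + 1), p i, θ i) ∈ C) :
    (walkWeight m θ = 0 → ℓ (p 0) = ℓ (p m)) ∧ (walkWeight m θ = 1 → ℓ (p 0) ≠ ℓ (p m)) := by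
  induction m with
  | zero => simp [walkWeight]
  | succ m ih =>
    obtain ⟨ih0, ih1⟩ := ih fun i hi => hs i (by omega)
    have hw : walkWeight (m + 1) θ = walkWeight m θ + if θ m then 1 else 0 :=
      Finset.sum_range_succ _ _
    have hstep : if θ m then ℓ (p m) ≠ ℓ (p (m + 1)) else ℓ (p m) = ℓ (p (m + 1)) := by
      rcases hs m (by omega) with h | h
      · exact hℓ _ h
      · have := hℓ _ h
        simp only [Satisfies] at this
        split_ifs at this ⊢
        · exact this.symm
        · exact this.symm
    by_cases ht : θ m = true
    · rw [if_pos ht] at hw hstep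
      exact ⟨fun h => by omega, fun h => ih0 (by omega) ▸ hstep⟩
    · rw [if_neg ht] at hw hstep
      exact ⟨fun h => (ih0 (hw.symm.trans h)).trans hstep, fun h => hstep ▸ ih1 (hw.symm.trans h)⟩

theorem exists_labeling_mustLink {V : Type*} [Finite V] (C : Finset (V × V × Bool)) :
    ∃ f : V → ℕ, ∀ a b, f a = f b ↔ (mustLinkSetoid C).r a b := by
  obtain ⟨g, hg⟩ := exists_injective_nat (Quotient (mustLinkSetoid C))
  exact ⟨fun a => g (Quotient.mk _ a), fun a b => hg.eq_iff.trans Quotient.eq⟩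

/-- Theorem 1: pairwise constraint deduction via the minimum-weight path.
`w` is the minimum weight over all walks from `x` to `y` in `C`. -/
theorem deduction_min_weight_path {V : Type*} [Fintype V]
    (C : Finset (V × V × Bool)) (x y : V) (hxy : x ≠ y)
    (hsat : ∃ ℓ : V → ℕ, Consistent ℓ C)
    (w : ℕ)
    (hmin : ∃ m p θ, IsWalk C x y m p θ ∧ walkWeight m θ = w)
    (hlb : ∀ m p θ, IsWalk C x y m p θ → w ≤ walkWeight m θ) :
    (w = 0 → ∀ ℓ : V → ℕ, Consistent ℓ C → ℓ x = ℓ y) ∧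
    (w = 1 → ∀ ℓ : V → ℕ, Consistent ℓ C → ℓ x ≠ ℓ y) ∧
    (2 ≤ w → (∃ ℓ₁ : V → ℕ, Consistent ℓ₁ C ∧ ℓ₁ x = ℓ₁ y) ∧
             (∃ ℓ₂ : V → ℕ, Consistent ℓ₂ C ∧ ℓ₂ x ≠ ℓ₂ y)) := by
  refine ⟨?_, ?_, ?_⟩
  · rintro rfl ℓ hℓ
    obtain ⟨m, p, θ, ⟨rfl, rfl, hs⟩, hw⟩ := hmin
    exact (hℓ.of_walkWeight m hs).1 hw
  · rintro rfl ℓ hℓ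
    obtain ⟨m, p, θ, ⟨rfl, rfl, hs⟩, hw⟩ := hmin
    exact (hℓ.of_walkWeight m hs).2 hw
  · intro hw
    have hno : ∀ k < 2, ¬ HasWalk C x y k := by
      rintro k hk ⟨m, p, θ, hp, hpk⟩
      have := hlb m p θ hp
      omega
    obtain ⟨ℓ, hℓ⟩ := hsat
    obtain ⟨f, hf⟩ := exists_labeling_mustLink C
    have hcl : ∀ a b, (a, b, true) ∈ C → f a ≠ f b := fun a b hab h => by
      have hne : ℓ a ≠ ℓ b := by simpa [Satisfies] using hℓ _ hab
      exact hne (hℓ.eq_of_mustLink ((hf a b).1 h))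
    have hml : ∀ a b, (a, b, false) ∈ C → f a = f b := fun a b hab =>
      (hf a b).2 (Relation.EqvGen.rel a b hab)
    have hcross : ∀ a b, (a, b, true) ∈ C ∨ (b, a, true) ∈ C → f a = f x → f b ≠ f y := by
      intro a b hab ha hb
      have hby := (hasWalk_iff_of_mustLink ((hf b y).1 hb) y 0).2 (HasWalk.refl C y)
      exact hno 1 (by omega) ((hasWalk_iff_of_mustLink ((hf a x).1 ha) y 1).1 (hby.cons hab))
    refine ⟨⟨fun a => if f a = f x then f y else f a, ?_, by simp⟩, f, ?_, ?_⟩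
    · rintro ⟨a, b, _ | _⟩ hab
      · simp [Satisfies, hml a b hab]
      · have h₁ := hcl a b hab
        have h₂ := hcross a b (.inl hab)
        have h₃ := hcross b a (.inr hab)
        simp only [Satisfies, if_true]
        split_ifs with ha hb hb
        · exact absurd (ha.trans hb.symm) h₁
        · exact (h₂ ha).symm
        · exact h₃ hb
        · exact h₁
    · rintro ⟨a, b, _ | _⟩ hab
      · simpa [Satisfies] using hml a b hab
      · simpa [Satisfies] using hcl a b hab
    · intro h
      exact hno 0 (by omega) ((hasWalk_iff_of_mustLink ((hf x y).1 h) y 0).2 (HasWalk.refl C y))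
end

section
/- Let S be a finite set of at least two points in a metric space such that the distances dist(p,q) over unordered pairs {p,q} of distinct points of S are pairwise distinct, and for p ∈ S let N(p) denote the unique point q ∈ S with q ≠ p minimizing dist(p,q). Then the collection M of reciprocal nearest neighbor pairs, i.e., unordered pairs {p,q} of distinct points of S with N(p) = q and N(q) = p, is a partial matching: any two distinct pairs in M are disjoint. Consequently 1 ≤ |M| ≤ |S| / 2, so each DSInit iteration replaces the representatives by at most half as many (one per RNN pair) and strictly decreases their number. -/
/-- The nearest neighbor relation on a finite set `S` with pairwise distinct distances:
`q` is the (unique) nearest neighbor of `p` in `S`. -/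
def IsNN {V : Type*} [MetricSpace V] (S : Finset V) (p q : V) : Prop :=
  q ∈ S ∧ q ≠ p ∧ ∀ r ∈ S, r ≠ p → dist p q ≤ dist p r

/-- The reciprocal nearest neighbor pairs of `S`, as unordered pairs. -/
def RNNPairs {V : Type*} [MetricSpace V] (S : Finset V) : Set (Sym2 V) :=
  {z | ∃ a b : V, z = s(a, b) ∧ a ∈ S ∧ b ∈ S ∧ a ≠ b ∧ IsNN S a b ∧ IsNN S b a}

open Classical in
/-- Pairwise disjoint off-diagonal unordered pairs drawn from a finite set `S` number at most
half the elements of `S`. -/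
theorem Sym2.two_mul_ncard_le_card_of_disjoint {V : Type*} {S : Finset V} {M : Set (Sym2 V)}
    (hsub : ∀ z ∈ M, ∀ v ∈ z, v ∈ S) (hdiag : ∀ z ∈ M, ¬ z.IsDiag)
    (hdisj : ∀ z ∈ M, ∀ z' ∈ M, z ≠ z' → ∀ v : V, v ∈ z → v ∉ z') :
    2 * M.ncard ≤ S.card := by
  have hfin : M.Finite :=
    S.sym2.finite_toSet.subset fun z hz => Finset.mem_coe.2 (Finset.mem_sym2_iff.2 (hsub z hz))
  have hcard : (hfin.toFinset.biUnion Sym2.toFinset).card = hfin.toFinset.card * 2 := by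
    rw [Finset.card_biUnion, Finset.sum_const_nat]
    · intro z hz
      exact Sym2.card_toFinset_of_not_isDiag z (hdiag z (hfin.mem_toFinset.1 hz))
    · intro z hz z' hz' hne
      rw [Finset.mem_coe, hfin.mem_toFinset] at hz hz'
      refine Finset.disjoint_left.2 fun v hv hv' => ?_
      exact hdisj z hz z' hz' hne v
        (Sym2.mem_toFinset.1 hv) (Sym2.mem_toFinset.1 hv')
  rw [Set.ncard_eq_toFinset_card M hfin, mul_comm, ← hcard]
  refine Finset.card_le_card (Finset.biUnion_subset.2 fun z hz v hv => ?_)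
  exact hsub z (hfin.mem_toFinset.1 hz) v (Sym2.mem_toFinset.1 hv)

section NearestNeighbor

variable {V : Type*} [MetricSpace V] {S : Finset V}

theorem IsNN.unique
    (hdistinct : ∀ p ∈ S, ∀ q ∈ S, ∀ r ∈ S, ∀ s ∈ S, p ≠ q → r ≠ s →
      dist p q = dist r s → (p = r ∧ q = s) ∨ (p = s ∧ q = r))
    {p q r : V} (hp : p ∈ S) (hq : IsNN S p q) (hr : IsNN S p r) : q = r := by
  have hdist : dist p q = dist p r :=
    le_antisymm (hq.2.2 r hr.1 hr.2.1) (hr.2.2 q hq.1 hq.2.1)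
  rcases hdistinct p hp q hq.1 p hp r hr.1 hq.2.1.symm hr.2.1.symm hdist with h | h
  · exact h.2
  · exact absurd h.2 hq.2.1

/-- Seen from any of its members, an RNN pair consists of that member and a nearest neighbor. -/
theorem exists_isNN_of_mem_RNNPairs {z : Sym2 V} (hz : z ∈ RNNPairs S) {v : V} (hv : v ∈ z) :
    v ∈ S ∧ ∃ w, z = s(v, w) ∧ IsNN S v w := by
  obtain ⟨a, b, rfl, ha, hb, -, hab, hba⟩ := hz
  rcases Sym2.mem_iff.1 hv with rfl | rfl
  · exact ⟨ha, b, rfl, hab⟩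
  · exact ⟨hb, a, Sym2.eq_swap, hba⟩

/-- A closest pair of points is an RNN pair. -/
theorem RNNPairs_nonempty (hcard : 2 ≤ S.card) : (RNNPairs S).Nonempty := by
  classical
  obtain ⟨a, ha, b, hb, hab⟩ := Finset.one_lt_card.1 hcard
  obtain ⟨⟨p, q⟩, hpq, hmin⟩ := S.offDiag.exists_min_image (fun x => dist x.1 x.2)
    ⟨(a, b), Finset.mem_offDiag.2 ⟨ha, hb, hab⟩⟩
  obtain ⟨hp, hq, hne⟩ := Finset.mem_offDiag.1 hpq
  refine ⟨s(p, q), p, q, rfl, hp, hq, hne, ⟨hq, hne.symm, fun r hr hrp => ?_⟩,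
    ⟨hp, hne, fun r hr hrq => ?_⟩⟩
  · exact hmin (p, r) (Finset.mem_offDiag.2 ⟨hp, hr, hrp.symm⟩)
  · rw [dist_comm q p]
    exact hmin (q, r) (Finset.mem_offDiag.2 ⟨hq, hr, hrq.symm⟩)

end NearestNeighbor

/-- The reciprocal nearest neighbor pairs form a nonempty partial matching:
distinct RNN pairs are vertex-disjoint, and `1 ≤ |M| ≤ |S| / 2`. -/
theorem RNN_pairs_partial_matching {V : Type*} [MetricSpace V] (S : Finset V)
    (hcard : 2 ≤ S.card)
    (hdistinct : ∀ p ∈ S, ∀ q ∈ S, ∀ r ∈ S, ∀ s ∈ S, p ≠ q → r ≠ s →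
      dist p q = dist r s → (p = r ∧ q = s) ∨ (p = s ∧ q = r)) :
    (∀ z ∈ RNNPairs S, ∀ z' ∈ RNNPairs S, z ≠ z' → ∀ v : V, v ∈ z → v ∉ z') ∧
    1 ≤ (RNNPairs S).ncard ∧ 2 * (RNNPairs S).ncard ≤ S.card := by
  have hdisj : ∀ z ∈ RNNPairs S, ∀ z' ∈ RNNPairs S, z ≠ z' → ∀ v : V, v ∈ z → v ∉ z' := by
    intro z hz z' hz' hne v hv hv'
    obtain ⟨hvS, w, rfl, hw⟩ := exists_isNN_of_mem_RNNPairs hz hv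
    obtain ⟨-, w', rfl, hw'⟩ := exists_isNN_of_mem_RNNPairs hz' hv'
    exact hne (by rw [hw.unique hdistinct hvS hw'])
  have hsub : ∀ z ∈ RNNPairs S, ∀ v ∈ z, v ∈ S :=
    fun z hz v hv => (exists_isNN_of_mem_RNNPairs hz hv).1
  have hdiag : ∀ z ∈ RNNPairs S, ¬ z.IsDiag := by
    rintro _ ⟨a, b, rfl, -, -, hab, -⟩
    exact hab
  have hfin : (RNNPairs S).Finite :=
    S.sym2.finite_toSet.subset fun z hz => Finset.mem_coe.2 (Finset.mem_sym2_iff.2 (hsub z hz))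
  exact ⟨hdisj, (Set.ncard_pos hfin).2 (RNNPairs_nonempty hcard),
    Sym2.two_mul_ncard_le_card_of_disjoint hsub hdiag hdisj⟩
end
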